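/- Over the frame (ℕ,<), a monotone hybrid formula φ ∈ MHL(□,↓) (built from state variables, ⊤, ⊥, ∧, ∨, □ and binders ↓x., with no negation, no ◇ and no @) is satisfiable (there exist an assignment g : SVAR → ℕ and k ∈ ℕ with g,k ⊨ φ) if and only if g₀,0 ⊨ φ, where g₀ is the assignment mapping every state variable to 0. -/

import Mathlib

/-- Formulas of monotone hybrid logic MHL(□,↓) over state variables. -/
inductive HForm : Type
  | svar : ℕ → HForm
  | top : HForm
  | bot : HForm
  | conj : HForm → HForm → HForm
  | disj : HForm → HForm → HForm
  | box : HForm → HForm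
  | bind : ℕ → HForm → HForm

/-- Satisfaction over the frame (ℕ,<) with assignment g. -/
def sat (g : ℕ → ℕ) (k : ℕ) : HForm → Prop
  | .svar x => g x = k
  | .top => True
  | .bot => False
  | .conj a b => sat g k a ∧ sat g k b
  | .disj a b => sat g k a ∨ sat g k b
  | .box a => ∀ k' > k, sat g k' a
  | .bind x a => sat (Function.update g x k) k a


/-- Symbolic evaluation: `E` is the set of variables naming the current point. -/
def symb (E : Set ℕ) : HForm → Prop
  | .svar x => x ∈ E
  | .top => True
  | .bot => False
  | .conj a b => symb E a ∧ symb E b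
  | .disj a b => symb E a ∨ symb E b
  | .box a => symb ∅ a
  | .bind x a => symb (insert x E) a

theorem symb_sound (φ : HForm) : ∀ (E : Set ℕ) (g : ℕ → ℕ) (k : ℕ),
    (∀ x ∈ E, g x = k) → symb E φ → sat g k φ := by
  induction φ with
  | svar x => intro E g k h hs; exact h x hs
  | top => intros; trivial
  | bot => intro E g k h hs; exact hs
  | conj a b iha ihb => intro E g k h hs; exact ⟨iha E g k h hs.1, ihb E g k h hs.2⟩
  | disj a b iha ihb => intro E g k h hs; exact hs.imp (iha E g k h) (ihb E g k h)
  | box a ih => intro E g k h hs k' _; exact ih ∅ g k' (by simp) hs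
  | bind x a ih =>
    intro E g k h hs
    refine ih (insert x E) _ k ?_ hs
    intro y hy
    by_cases hyx : y = x
    · subst hyx; simp
    · rw [Function.update_of_ne hyx]
      exact h y (hy.resolve_left hyx)

theorem symb_complete (φ : HForm) : ∃ N : ℕ, ∀ (E : Set ℕ) (g : ℕ → ℕ) (k : ℕ),
    (∀ x < N, g x = k → x ∈ E) → sat g k φ → symb E φ := by
  induction φ with
  | svar x => exact ⟨x + 1, fun E g k h hs => h x (by omega) hs⟩
  | top => exact ⟨0, fun _ _ _ _ _ => trivial⟩
  | bot => exact ⟨0, fun _ _ _ _ hs => hs⟩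
  | conj a b iha ihb =>
    obtain ⟨N, hN⟩ := iha
    obtain ⟨M, hM⟩ := ihb
    exact ⟨N + M, fun E g k h hs => ⟨hN E g k (fun x hx => h x (by omega)) hs.1,
      hM E g k (fun x hx => h x (by omega)) hs.2⟩⟩
  | disj a b iha ihb =>
    obtain ⟨N, hN⟩ := iha
    obtain ⟨M, hM⟩ := ihb
    exact ⟨N + M, fun E g k h hs => hs.imp (hN E g k (fun x hx => h x (by omega)))
      (hM E g k (fun x hx => h x (by omega)))⟩
  | box a ih =>
    obtain ⟨N, hN⟩ := ih
    refine ⟨N, fun E g k _ hs => ?_⟩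
    refine hN ∅ g (k + 1 + ∑ x ∈ Finset.range N, g x) ?_ (hs _ (by omega))
    intro x hx he
    have := Finset.single_le_sum (f := g) (fun i _ => Nat.zero_le _) (Finset.mem_range.2 hx)
    omega
  | bind x a ih =>
    obtain ⟨N, hN⟩ := ih
    refine ⟨N, fun E g k h hs => hN (insert x E) _ k ?_ hs⟩
    intro y hy he
    by_cases hyx : y = x
    · exact Or.inl hyx
    · rw [Function.update_of_ne hyx] at he
      exact Or.inr (h y hy he)

/-- φ ∈ MHL(□,↓) is satisfiable over (ℕ,<) iff g₀,0 ⊨ φ where g₀ maps every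
state variable to 0. -/
theorem stmt4 (φ : HForm) :
    (∃ (g : ℕ → ℕ) (k : ℕ), sat g k φ) ↔ sat (fun _ => 0) 0 φ := by
  constructor
  · rintro ⟨g, k, h⟩
    obtain ⟨N, hN⟩ := symb_complete φ
    exact symb_sound φ Set.univ _ _ (fun _ _ => rfl)
      (hN Set.univ g k (fun _ _ _ => Set.mem_univ _) h)
  · intro h
    exact ⟨_, _, h⟩
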